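/- arXiv:2510.18682 — 5 statements merged into one kernel-verified Lean document; each statement's English description precedes it below -/
import Mathlib

section
/- Let C = [0,1]², let G : ℝ² → ℝ² be G(x₁, x₂) = (x₁² + x₂, x₂² − x₁), let ψ^S(x) := sup{⟨G(x), x − y⟩ : y ∈ C}, and let ε = 65/4096. Then ψ^S((0,0)) ≤ ε and ψ^S((1/16, 1/4)) ≤ ε, but ψ^S((1/32, 1/8)) > ε, where (1/32, 1/8) is the midpoint of (0,0) and (1/16, 1/4); consequently the set {x ∈ C : ψ^S(x) ≤ ε} is not convex. -/
open RealInnerProductSpace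

/-- The map `G(x₁,x₂) = (x₁² + x₂, x₂² − x₁)` on `ℝ²`. -/
noncomputable def G2 (x : EuclideanSpace ℝ (Fin 2)) : EuclideanSpace ℝ (Fin 2) :=
  (WithLp.equiv 2 (Fin 2 → ℝ)).symm ![x 0 ^ 2 + x 1, x 1 ^ 2 - x 0]

/-- The square `[0,1]²` in `ℝ²`. -/
def unitSquare : Set (EuclideanSpace ℝ (Fin 2)) :=
  {x | x 0 ∈ Set.Icc (0 : ℝ) 1 ∧ x 1 ∈ Set.Icc (0 : ℝ) 1}

/-- The Stampacchia gap function of `G2` on `[0,1]²`. -/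
noncomputable def psiS (x : EuclideanSpace ℝ (Fin 2)) : ℝ :=
  sSup ((fun y => ⟪G2 x, x - y⟫) '' unitSquare)

/-- The point `(p, q)` of `ℝ²`. -/
noncomputable def pt (p q : ℝ) : EuclideanSpace ℝ (Fin 2) :=
  (WithLp.equiv 2 (Fin 2 → ℝ)).symm ![p, q]

lemma inner_G2_pt_sub (p q : ℝ) (y : EuclideanSpace ℝ (Fin 2)) :
    ⟪G2 (pt p q), pt p q - y⟫ = (p ^ 2 + q) * (p - y 0) + (q ^ 2 - p) * (q - y 1) := by
  simp [G2, pt, PiLp.inner_apply, Fin.sum_univ_two]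
  ring

lemma pt_mem_unitSquare {p q : ℝ} (hp : p ∈ Set.Icc (0 : ℝ) 1) (hq : q ∈ Set.Icc (0 : ℝ) 1) :
    pt p q ∈ unitSquare := by
  simpa [pt, unitSquare] using And.intro hp hq

lemma psiS_pt_le {p q c : ℝ}
    (h : ∀ a ∈ Set.Icc (0 : ℝ) 1, ∀ b ∈ Set.Icc (0 : ℝ) 1,
      (p ^ 2 + q) * (p - a) + (q ^ 2 - p) * (q - b) ≤ c) :
    psiS (pt p q) ≤ c := by
  refine csSup_le (Set.Nonempty.image _ ⟨pt 0 0, pt_mem_unitSquare (by simp) (by simp)⟩) ?_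
  rintro _ ⟨y, hy, rfl⟩
  simpa only [inner_G2_pt_sub] using h _ hy.1 _ hy.2

lemma le_psiS_pt {p q c a b : ℝ}
    (h : ∀ a ∈ Set.Icc (0 : ℝ) 1, ∀ b ∈ Set.Icc (0 : ℝ) 1,
      (p ^ 2 + q) * (p - a) + (q ^ 2 - p) * (q - b) ≤ c)
    (ha : a ∈ Set.Icc (0 : ℝ) 1) (hb : b ∈ Set.Icc (0 : ℝ) 1) :
    (p ^ 2 + q) * (p - a) + (q ^ 2 - p) * (q - b) ≤ psiS (pt p q) := by
  refine le_csSup ⟨c, ?_⟩ ⟨pt a b, pt_mem_unitSquare ha hb, ?_⟩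
  · rintro _ ⟨y, hy, rfl⟩
    simpa only [inner_G2_pt_sub] using h _ hy.1 _ hy.2
  · simp only [inner_G2_pt_sub]
    simp [pt]

/-- With `ε = 65/4096`, the points `(0,0)` and `(1/16, 1/4)` are
`ε`-solutions of the Stampacchia variational inequality for `G2` on `[0,1]²` but their
midpoint `(1/32, 1/8)` is not; hence the `ε`-solution set is not convex. -/
theorem eps_solution_set_not_convex :
    psiS (pt 0 0) ≤ 65 / 4096 ∧
    psiS (pt (1 / 16) (1 / 4)) ≤ 65 / 4096 ∧
    pt (1 / 32) (1 / 8) = midpoint ℝ (pt 0 0) (pt (1 / 16) (1 / 4)) ∧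
    psiS (pt (1 / 32) (1 / 8)) > 65 / 4096 ∧
    ¬ Convex ℝ {x ∈ unitSquare | psiS x ≤ 65 / 4096} := by
  have h₀ : psiS (pt 0 0) ≤ 65 / 4096 := psiS_pt_le (by intros; norm_num)
  have h₁ : psiS (pt (1 / 16) (1 / 4)) ≤ 65 / 4096 := by
    refine psiS_pt_le ?_
    rintro a ⟨ha, -⟩ b -
    norm_num
    linarith
  have hmid : pt (1 / 32) (1 / 8) = midpoint ℝ (pt 0 0) (pt (1 / 16) (1 / 4)) := by
    ext i
    fin_cases i <;> simp [pt, midpoint_eq_smul_add] <;> norm_num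
  have h₂ : psiS (pt (1 / 32) (1 / 8)) > 65 / 4096 := by
    have h := le_psiS_pt (p := 1 / 32) (q := 1 / 8) (c := 1) (a := 0) (b := 1) (by
      rintro a ⟨ha, -⟩ b ⟨-, hb⟩
      norm_num
      linarith) (by simp) (by simp)
    norm_num at h ⊢
    linarith
  refine ⟨h₀, h₁, hmid, h₂, fun hconv => ?_⟩
  have hmem := hconv.midpoint_mem
    (show pt 0 0 ∈ {x ∈ unitSquare | psiS x ≤ 65 / 4096} from
      ⟨pt_mem_unitSquare (by simp) (by simp), h₀⟩)
    (show pt (1 / 16) (1 / 4) ∈ {x ∈ unitSquare | psiS x ≤ 65 / 4096} from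
      ⟨pt_mem_unitSquare (by norm_num) (by norm_num), h₁⟩)
  rw [← hmid] at hmem
  exact absurd hmem.2 (not_le.mpr h₂)
end

section
/- Let C ⊆ ℝ^n be nonempty, convex and compact, let f : ℝ^n → ℝ be convex, and let G : ℝ^n → ℝ^n be continuous and monotone. Let ψ^M(x) := sup{⟨G(y), x − y⟩ : y ∈ C}. Let (ε_k) be a sequence of positive reals with ε_k → 0 and for each k let x_k be an optimal solution of min{f(x) : x ∈ C, ψ^M(x) ≤ ε_k}. Then every cluster point x̄ of the sequence (x_k) satisfies ψ^M(x̄) ≤ 0 and f(x̄) ≤ f(x) for every x ∈ C with ψ^M(x) ≤ 0; that is, x̄ is an optimal solution of min{f(x) : x ∈ C, ψ^M(x) ≤ 0}. -/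
open RealInnerProductSpace

/-- The Minty gap function `ψ^M(x) = sup {⟪G y, x - y⟫ : y ∈ C}`. -/
noncomputable def psiM {n : ℕ} (G : EuclideanSpace ℝ (Fin n) → EuclideanSpace ℝ (Fin n))
    (C : Set (EuclideanSpace ℝ (Fin n))) (x : EuclideanSpace ℝ (Fin n)) : ℝ :=
  sSup ((fun y => ⟪G y, x - y⟫) '' C)

theorem continuous_psiM {n : ℕ} {C : Set (EuclideanSpace ℝ (Fin n))} (hcomp : IsCompact C)
    {G : EuclideanSpace ℝ (Fin n) → EuclideanSpace ℝ (Fin n)} (hGc : Continuous G) :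
    Continuous (psiM G C) :=
  hcomp.continuous_sSup (by fun_prop)

/-- If `x k` is optimal for `(ε_k-OPMVI)` and `ε_k ↓ 0`, then every
cluster point of `(x k)` is an optimal solution of `min {f(x) : x ∈ C, ψ^M(x) ≤ 0}`. -/
theorem cluster_points_of_inexact_solutions {n : ℕ} (C : Set (EuclideanSpace ℝ (Fin n)))
    (hne : C.Nonempty) (hconv : Convex ℝ C) (hcomp : IsCompact C)
    (f : EuclideanSpace ℝ (Fin n) → ℝ) (hf : ConvexOn ℝ Set.univ f)
    (G : EuclideanSpace ℝ (Fin n) → EuclideanSpace ℝ (Fin n))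
    (hGc : Continuous G)
    (hGm : ∀ x y : EuclideanSpace ℝ (Fin n), 0 ≤ ⟪G x - G y, x - y⟫)
    (ε : ℕ → ℝ) (hεpos : ∀ k, 0 < ε k) (hεlim : Filter.Tendsto ε Filter.atTop (nhds 0))
    (x : ℕ → EuclideanSpace ℝ (Fin n))
    (hxC : ∀ k, x k ∈ C) (hxfeas : ∀ k, psiM G C (x k) ≤ ε k)
    (hxopt : ∀ k, ∀ z ∈ C, psiM G C z ≤ ε k → f (x k) ≤ f z)
    (x' : EuclideanSpace ℝ (Fin n)) (hx' : MapClusterPt x' Filter.atTop x) :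
    x' ∈ C ∧ psiM G C x' ≤ 0 ∧ ∀ z ∈ C, psiM G C z ≤ 0 → f x' ≤ f z := by
  obtain ⟨φ, hφ, hlim⟩ := hx'.tendsto_subseq
  refine ⟨hcomp.isClosed.mem_of_tendsto hlim (.of_forall fun k => hxC _), ?_, fun z hz hz0 => ?_⟩
  · have hlim0 : Filter.Tendsto (psiM G C ∘ x ∘ φ) Filter.atTop (nhds (psiM G C x')) :=
      ((continuous_psiM hcomp hGc).tendsto x').comp hlim
    exact le_of_tendsto_of_tendsto' hlim0 (hεlim.comp hφ.tendsto_atTop) fun k => hxfeas _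
  · have hfc : Continuous f := continuousOn_univ.1 (hf.continuousOn isOpen_univ)
    exact le_of_tendsto' ((hfc.tendsto x').comp hlim) fun k =>
      hxopt _ z hz (hz0.trans (hεpos _).le)
end

section
/- Let C ⊆ ℝ^n be nonempty, convex and compact and let G : ℝ^n → ℝ^n be continuous and monotone. Then for every nonempty subset B ⊆ C there exists x ∈ C with ψ^M_B(x) ≤ 0, where ψ^M_B(x) := sup{⟨G(y), x − y⟩ : y ∈ B}. Consequently, for every ε > 0, any point x̄ minimizing ψ^M_B over C satisfies ψ^M_B(x̄) < ε. -/
open RealInnerProductSpace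

/-- The approximated Minty gap function `ψ^M_B(x) = sup {⟪G y, x - y⟫ : y ∈ B}`. -/
noncomputable def psiMB {n : ℕ} (G : EuclideanSpace ℝ (Fin n) → EuclideanSpace ℝ (Fin n))
    (B : Set (EuclideanSpace ℝ (Fin n))) (x : EuclideanSpace ℝ (Fin n)) : ℝ :=
  sSup ((fun y => ⟪G y, x - y⟫) '' B)

/-- A finite family of pairwise monotone pairs `(y i, g i)` with `y i ∈ C` has a common solution
of the Minty inequalities in `C`. -/
theorem exists_forall_inner_sub_nonpos {E ι : Type*} [NormedAddCommGroup E]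
    [InnerProductSpace ℝ E] [Fintype ι] {C : Set E} (hne : C.Nonempty) (hconv : Convex ℝ C)
    (hcomp : IsCompact C) (y g : ι → E) (hy : ∀ i, y i ∈ C)
    (hmono : ∀ i j, 0 ≤ ⟪g i - g j, y i - y j⟫) :
    ∃ x ∈ C, ∀ i, ⟪g i, x - y i⟫ ≤ 0 := by
  classical
  by_contra! hno
  set Φ : E → ι → ℝ := fun x i => ⟪g i, x - y i⟫ with hΦ
  have hKcomp : IsCompact (Φ '' C) := hcomp.image (by fun_prop)
  have hKconv : Convex ℝ (Φ '' C) := by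
    rintro _ ⟨p, hp, rfl⟩ _ ⟨q, hq, rfl⟩ a b ha hb hab
    refine ⟨a • p + b • q, hconv hp hq ha hb hab, ?_⟩
    ext i
    simp only [hΦ, Pi.add_apply, Pi.smul_apply, smul_eq_mul, inner_sub_right, inner_add_right,
      inner_smul_right]
    linear_combination (⟪g i, y i⟫) * hab
  have hdisj : Disjoint (Φ '' C) (Set.Iic (0 : ι → ℝ)) := by
    rw [Set.disjoint_left]
    rintro _ ⟨p, hp, rfl⟩ hle
    obtain ⟨i, hi⟩ := hno p hp
    exact absurd (hle i) (not_le.mpr hi)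
  obtain ⟨f, u, v, hfu, huv, hfv⟩ :=
    geometric_hahn_banach_compact_closed hKconv hKcomp (convex_Iic _) isClosed_Iic hdisj
  have hv : v < 0 := by simpa using hfv 0 (Set.mem_Iic.mpr le_rfl)
  have hexp (w : ι → ℝ) : f w = ∑ i, w i * f (Pi.single i 1) := by
    conv_lhs => rw [pi_eq_sum_univ' w]
    simp only [map_sum, map_smul, smul_eq_mul]
  set m : ι → ℝ := fun i => -f (Pi.single i 1) with hm
  have hm0 (i : ι) : 0 ≤ m i := by
    by_contra! hneg
    have hpos : 0 < f (Pi.single i 1) := by simpa [hm] using hneg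
    have h := hfv ((v / f (Pi.single i 1)) • Pi.single i 1) (by
      rw [Set.mem_Iic]
      exact smul_nonpos_of_nonpos_of_nonneg (div_neg_of_neg_of_pos hv hpos).le
        (Pi.single_nonneg.mpr zero_le_one))
    rw [map_smul, smul_eq_mul, div_mul_cancel₀ _ hpos.ne'] at h
    exact lt_irrefl _ h
  have hpos (x : E) (hx : x ∈ C) : 0 < ∑ i, m i * ⟪g i, x - y i⟫ := by
    have h := (hfu _ ⟨x, hx, rfl⟩).trans (huv.trans hv)
    rw [hexp] at h
    have : ∑ i, m i * ⟪g i, x - y i⟫ = -∑ i, Φ x i * f (Pi.single i 1) := by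
      rw [← Finset.sum_neg_distrib]
      exact Finset.sum_congr rfl fun i _ => by simp only [hm, hΦ]; ring
    linarith
  have hS : 0 < ∑ i, m i := by
    refine (Finset.sum_nonneg fun i _ => hm0 i).lt_of_ne' fun h0 => ?_
    obtain ⟨x, hx⟩ := hne
    have hz := (Finset.sum_eq_zero_iff_of_nonneg fun i _ => hm0 i).mp h0
    have h := hpos x hx
    rw [Finset.sum_eq_zero fun i hi => by rw [hz i hi, zero_mul]] at h
    exact lt_irrefl _ h
  set c := Finset.univ.centerMass m y with hc
  have hcC : c ∈ C := hconv.centerMass_mem (fun i _ => hm0 i) hS fun i _ => hy i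
  have hSc : (∑ i, m i) • c = ∑ i, m i • y i := by
    rw [hc, Finset.centerMass, smul_inv_smul₀ hS.ne']
  have hdouble : (∑ j, m j) * ∑ i, m i * ⟪g i, c - y i⟫ =
      ∑ i, ∑ j, m i * m j * ⟪g i, y j - y i⟫ := by
    rw [Finset.mul_sum]
    refine Finset.sum_congr rfl fun i _ => ?_
    have h : (∑ j, m j) * ⟪g i, c - y i⟫ = ∑ j, m j * ⟪g i, y j - y i⟫ := by
      rw [← inner_smul_right, smul_sub, hSc, Finset.sum_smul, ← Finset.sum_sub_distrib, inner_sum]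
      simp only [← smul_sub, inner_smul_right]
    rw [mul_left_comm, h, Finset.mul_sum]
    exact Finset.sum_congr rfl fun j _ => by ring
  have hsymm : 2 * ∑ i, ∑ j, m i * m j * ⟪g i, y j - y i⟫ =
      -∑ i, ∑ j, m i * m j * ⟪g i - g j, y i - y j⟫ := by
    rw [two_mul]
    nth_rewrite 2 [Finset.sum_comm]
    simp only [← Finset.sum_add_distrib, ← Finset.sum_neg_distrib]
    refine Finset.sum_congr rfl fun i _ => Finset.sum_congr rfl fun j _ => ?_
    simp only [inner_sub_left, inner_sub_right]
    ring
  have hnonneg : 0 ≤ ∑ i, ∑ j, m i * m j * ⟪g i - g j, y i - y j⟫ :=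
    Finset.sum_nonneg fun i _ => Finset.sum_nonneg fun j _ =>
      mul_nonneg (mul_nonneg (hm0 i) (hm0 j)) (hmono i j)
  have := mul_pos hS (hpos c hcC)
  linarith

/-- A monotone map has a solution of the Minty variational inequality over a nonempty compact
convex set. -/
theorem exists_minty_solution {E : Type*} [NormedAddCommGroup E] [InnerProductSpace ℝ E]
    {C : Set E} (hne : C.Nonempty) (hconv : Convex ℝ C) (hcomp : IsCompact C) (G : E → E)
    (hmono : ∀ x y, 0 ≤ ⟪G x - G y, x - y⟫) :
    ∃ x ∈ C, ∀ y ∈ C, ⟪G y, x - y⟫ ≤ 0 := by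
  obtain ⟨x, hx, hxy⟩ := hcomp.inter_iInter_nonempty
    (fun y : C => {x : E | ⟪G y, x - y⟫ ≤ 0})
    (fun y => isClosed_le (by fun_prop) continuous_const) (fun s => by
      obtain ⟨x, hx, h⟩ := exists_forall_inner_sub_nonpos hne hconv hcomp
        (fun i : s => (i : C).1) (fun i : s => G (i : C)) (fun i => (i : C).2)
        (fun i j => hmono _ _)
      exact ⟨x, hx, Set.mem_iInter₂.mpr fun i hi => h ⟨i, hi⟩⟩)
  exact ⟨x, hx, fun y hy => Set.mem_iInter.mp hxy ⟨y, hy⟩⟩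

/-- For every nonempty `B ⊆ C` there is a point of `C` where `ψ^M_B ≤ 0`;
hence for every `ε > 0` any minimizer of `ψ^M_B` over `C` has value `< ε`. -/
theorem psiMB_min_lt_eps {n : ℕ} (C : Set (EuclideanSpace ℝ (Fin n)))
    (hne : C.Nonempty) (hconv : Convex ℝ C) (hcomp : IsCompact C)
    (G : EuclideanSpace ℝ (Fin n) → EuclideanSpace ℝ (Fin n))
    (hGc : Continuous G)
    (hGm : ∀ x y : EuclideanSpace ℝ (Fin n), 0 ≤ ⟪G x - G y, x - y⟫)
    (B : Set (EuclideanSpace ℝ (Fin n))) (hBne : B.Nonempty) (hBsub : B ⊆ C) :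
    (∃ x ∈ C, psiMB G B x ≤ 0) ∧
      ∀ ε : ℝ, 0 < ε → ∀ x' ∈ C, (∀ z ∈ C, psiMB G B x' ≤ psiMB G B z) →
        psiMB G B x' < ε := by
  obtain ⟨x, hx, hxy⟩ := exists_minty_solution hne hconv hcomp G hGm
  have hle : psiMB G B x ≤ 0 :=
    csSup_le (hBne.image _) (Set.forall_mem_image.mpr fun y hy => hxy y (hBsub hy))
  exact ⟨⟨x, hx, hle⟩, fun ε hε x' _ hmin => ((hmin x hx).trans hle).trans_lt hε⟩
end

section
/- Let C ⊆ ℝ^n be nonempty and compact and let G : ℝ^n → ℝ^n be continuous. Let (B_k)_{k∈ℕ} be a sequence of nonempty subsets of C, define B̂_k as the closure of ⋃_{m ≥ k} B_m and B̂ := ⋂_{k∈ℕ} B̂_k. Then B̂ is nonempty and the functions ψ^M_{B̂_k} converge uniformly on C to ψ^M_{B̂} as k → ∞, where for B ⊆ C one sets ψ^M_B(x) := sup{⟨G(y), x − y⟩ : y ∈ B}; moreover the convergence is monotone: ψ^M_{B̂_k}(x) ≥ ψ^M_{B̂_{k+1}}(x) ≥ ψ^M_{B̂}(x) for all x ∈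 C and all k. -/
open RealInnerProductSpace

/-- The set `B̂ k = closure (⋃_{m ≥ k} B m)`. -/
def Bhat {n : ℕ} (B : ℕ → Set (EuclideanSpace ℝ (Fin n))) (k : ℕ) :
    Set (EuclideanSpace ℝ (Fin n)) :=
  closure (⋃ m, ⋃ (_ : k ≤ m), B m)

section

variable {n : ℕ} {C : Set (EuclideanSpace ℝ (Fin n))}
  {G : EuclideanSpace ℝ (Fin n) → EuclideanSpace ℝ (Fin n)}
  {B : ℕ → Set (EuclideanSpace ℝ (Fin n))}

theorem Bhat_antitone (B : ℕ → Set (EuclideanSpace ℝ (Fin n))) : Antitone (Bhat B) := by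
  intro j k hjk
  refine closure_mono (Set.iUnion_mono fun m => ?_)
  exact Set.iUnion_subset fun h => Set.subset_iUnion (fun _ : j ≤ m => B m) (hjk.trans h)

theorem Bhat_subset (hC : IsClosed C) (hB : ∀ k, B k ⊆ C) (k : ℕ) : Bhat B k ⊆ C :=
  closure_minimal (Set.iUnion₂_subset fun m _ => hB m) hC

theorem Bhat_nonempty (hB : ∀ k, (B k).Nonempty) (k : ℕ) : (Bhat B k).Nonempty :=
  ((hB k).mono (Set.subset_iUnion₂ (s := fun m (_ : k ≤ m) => B m) k le_rfl)).closure

theorem isCompact_Bhat (hC : IsCompact C) (hB : ∀ k, B k ⊆ C) (k : ℕ) : IsCompact (Bhat B k) :=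
  hC.of_isClosed_subset isClosed_closure (Bhat_subset hC.isClosed hB k)

theorem iInter_Bhat_nonempty (hC : IsCompact C) (hBne : ∀ k, (B k).Nonempty)
    (hB : ∀ k, B k ⊆ C) : (⋂ k, Bhat B k).Nonempty :=
  IsCompact.nonempty_iInter_of_sequence_nonempty_isCompact_isClosed _
    (fun k => Bhat_antitone B k.le_succ) (Bhat_nonempty hBne) (isCompact_Bhat hC hB 0)
    fun _ => isClosed_closure

theorem bddAbove_image_inner_sub (hC : IsCompact C) (hG : Continuous G)
    {S : Set (EuclideanSpace ℝ (Fin n))} (hS : S ⊆ C) (x : EuclideanSpace ℝ (Fin n)) :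
    BddAbove ((fun y => ⟪G y, x - y⟫) '' S) := by
  have hc : Continuous fun y => ⟪G y, x - y⟫ := by fun_prop
  exact (hC.bddAbove_image hc.continuousOn).mono (Set.image_mono hS)

theorem psiMB_mono (hC : IsCompact C) (hG : Continuous G)
    {S T : Set (EuclideanSpace ℝ (Fin n))} (hS : S.Nonempty) (hST : S ⊆ T) (hT : T ⊆ C)
    (x : EuclideanSpace ℝ (Fin n)) : psiMB G S x ≤ psiMB G T x :=
  csSup_le_csSup (bddAbove_image_inner_sub hC hG hT x) (hS.image _) (Set.image_mono hST)

theorem exists_forall_dist_inner_sub_lt (hC : IsCompact C) (hG : Continuous G) {ε : ℝ}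
    (hε : 0 < ε) :
    ∃ δ > 0, ∀ x ∈ C, ∀ y ∈ C, ∀ z ∈ C, dist y z < δ →
      dist ⟪G y, x - y⟫ ⟪G z, x - z⟫ < ε := by
  have hc : Continuous fun p : EuclideanSpace ℝ (Fin n) × EuclideanSpace ℝ (Fin n) =>
      ⟪G p.2, p.1 - p.2⟫ := by fun_prop
  obtain ⟨δ, hδ, h⟩ := Metric.uniformContinuousOn_iff.1
    ((hC.prod hC).uniformContinuousOn_of_continuous hc.continuousOn) ε hε
  refine ⟨δ, hδ, fun x hx y hy z hz hyz => h (x, y) ⟨hx, hy⟩ (x, z) ⟨hx, hz⟩ ?_⟩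
  simpa [Prod.dist_eq, hδ] using hyz

theorem exists_Bhat_subset_thickening (hC : IsCompact C) (hB : ∀ k, B k ⊆ C) {δ : ℝ}
    (hδ : 0 < δ) : ∃ N, Bhat B N ⊆ Metric.thickening δ (⋂ k, Bhat B k) :=
  exists_subset_nhds_of_isCompact (Bhat_antitone B).directed_ge (isCompact_Bhat hC hB)
    fun _ hx => Metric.isOpen_thickening.mem_nhds (Metric.self_subset_thickening hδ _ hx)

end

/-- With `B̂ = ⋂ k, B̂ k`, the set `B̂` is nonempty and
`ψ^M_{B̂ k} → ψ^M_{B̂}` uniformly on `C`; moreover the convergence is monotone. -/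
theorem psiMB_uniform_convergence {n : ℕ} (C : Set (EuclideanSpace ℝ (Fin n)))
    (hne : C.Nonempty) (hcomp : IsCompact C)
    (G : EuclideanSpace ℝ (Fin n) → EuclideanSpace ℝ (Fin n))
    (hGc : Continuous G)
    (B : ℕ → Set (EuclideanSpace ℝ (Fin n)))
    (hBne : ∀ k, (B k).Nonempty) (hBsub : ∀ k, B k ⊆ C) :
    (⋂ k, Bhat B k).Nonempty ∧
    TendstoUniformlyOn (fun k x => psiMB G (Bhat B k) x)
      (psiMB G (⋂ k, Bhat B k)) Filter.atTop C ∧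
    ∀ x ∈ C, ∀ k : ℕ,
      psiMB G (⋂ j, Bhat B j) x ≤ psiMB G (Bhat B (k + 1)) x ∧
      psiMB G (Bhat B (k + 1)) x ≤ psiMB G (Bhat B k) x := by
  have hsub := Bhat_subset hcomp.isClosed hBsub
  have hI : (⋂ k, Bhat B k).Nonempty := iInter_Bhat_nonempty hcomp hBne hBsub
  have hle (k : ℕ) x : psiMB G (⋂ j, Bhat B j) x ≤ psiMB G (Bhat B k) x :=
    psiMB_mono hcomp hGc hI (Set.iInter_subset _ k) (hsub k) x
  refine ⟨hI, Metric.tendstoUniformlyOn_iff.2 fun ε hε => ?_, fun x _ k => ⟨hle _ x,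
    psiMB_mono hcomp hGc (Bhat_nonempty hBne _) (Bhat_antitone B k.le_succ) (hsub k) x⟩⟩
  obtain ⟨δ, hδ, h⟩ := exists_forall_dist_inner_sub_lt hcomp hGc (half_pos hε)
  obtain ⟨N, hN⟩ := exists_Bhat_subset_thickening hcomp hBsub hδ
  filter_upwards [Filter.eventually_ge_atTop N] with k hk x hx
  have hup : psiMB G (Bhat B k) x ≤ psiMB G (⋂ j, Bhat B j) x + ε / 2 := by
    refine csSup_le ((Bhat_nonempty hBne k).image _) ?_
    rintro _ ⟨y, hy, rfl⟩
    obtain ⟨z, hz, hyz⟩ := Metric.mem_thickening_iff.1 (hN (Bhat_antitone B hk hy))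
    have hIC : (⋂ j, Bhat B j) ⊆ C := (Set.iInter_subset _ 0).trans (hsub 0)
    have hd := h x hx y (hsub k hy) z (hIC hz) hyz
    have hz' : ⟪G z, x - z⟫ ≤ psiMB G (⋂ j, Bhat B j) x :=
      le_csSup (bddAbove_image_inner_sub hcomp hGc hIC x) ⟨z, hz, rfl⟩
    rw [Real.dist_eq] at hd
    have := (abs_lt.1 hd).2
    dsimp only
    linarith
  have := hle k x
  rw [Real.dist_eq, abs_lt]
  constructor <;> linarith
end

section
/- Let C ⊆ ℝ^n be nonempty and convex, let G : ℝ^n → ℝ^n be L-Lipschitz continuous with L > 0, let D be the diameter of C, and let 0 < ε ≤ D²L. Let x, y ∈ C satisfy ⟨G(x), x − y⟩ > 2D√(Lε). Then, setting λ̄ := √ε/(D√L) and z := x + λ̄(y − x), one has λ̄ ∈ [0, 1], z ∈ C, and ⟨G(z), x − z⟩ > ε. -/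
open RealInnerProductSpace

/-- If `G` is `L`-Lipschitz, `D = diam C`, `0 < ε ≤ D² L` and
`x, y ∈ C` satisfy `⟪G x, x − y⟫ > 2 D √(L ε)`, then with `λ̄ = √ε / (D √L)` and
`z = x + λ̄ (y − x)` one has `λ̄ ∈ [0,1]`, `z ∈ C`, and `⟪G z, x − z⟫ > ε`. -/
theorem cut_from_stampacchia {n : ℕ} (C : Set (EuclideanSpace ℝ (Fin n)))
    (hne : C.Nonempty) (hconv : Convex ℝ C)
    (G : EuclideanSpace ℝ (Fin n) → EuclideanSpace ℝ (Fin n))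
    (L : ℝ) (hL : 0 < L)
    (hGlip : ∀ u v : EuclideanSpace ℝ (Fin n), ‖G u - G v‖ ≤ L * ‖u - v‖)
    (ε : ℝ) (hε : 0 < ε) (hεD : ε ≤ (Metric.diam C) ^ 2 * L)
    (x : EuclideanSpace ℝ (Fin n)) (hx : x ∈ C)
    (y : EuclideanSpace ℝ (Fin n)) (hy : y ∈ C)
    (hxy : 2 * Metric.diam C * Real.sqrt (L * ε) < ⟪G x, x - y⟫) :
    Real.sqrt ε / (Metric.diam C * Real.sqrt L) ∈ Set.Icc (0 : ℝ) 1 ∧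
    x + (Real.sqrt ε / (Metric.diam C * Real.sqrt L)) • (y - x) ∈ C ∧
    ε < ⟪G (x + (Real.sqrt ε / (Metric.diam C * Real.sqrt L)) • (y - x)),
          x - (x + (Real.sqrt ε / (Metric.diam C * Real.sqrt L)) • (y - x))⟫ := by
  have hD : 0 < Metric.diam C := by
    refine lt_of_le_of_ne Metric.diam_nonneg fun h => ?_
    rw [← h] at hεD
    norm_num at hεD
    linarith
  have hbdd : Bornology.IsBounded C := by
    by_contra h
    exact hD.ne' (Metric.diam_eq_zero_of_unbounded h)
  have hdist : ‖x - y‖ ≤ Metric.diam C := by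
    rw [← dist_eq_norm]
    exact Metric.dist_le_diam_of_mem hbdd hx hy
  rw [Real.sqrt_mul hL.le] at hxy
  set D := Metric.diam C
  have hs : 0 < Real.sqrt ε := Real.sqrt_pos.mpr hε
  have ht : 0 < Real.sqrt L := Real.sqrt_pos.mpr hL
  have hs2 : Real.sqrt ε ^ 2 = ε := Real.sq_sqrt hε.le
  have ht2 : Real.sqrt L ^ 2 = L := Real.sq_sqrt hL.le
  have hDt : 0 < D * Real.sqrt L := mul_pos hD ht
  have hl0 : 0 < Real.sqrt ε / (D * Real.sqrt L) := div_pos hs hDt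
  have hl1 : Real.sqrt ε / (D * Real.sqrt L) ≤ 1 := by
    rw [div_le_one hDt]
    refine le_of_sq_le_sq ?_ hDt.le
    rwa [mul_pow, hs2, ht2]
  have hlD : Real.sqrt ε / (D * Real.sqrt L) * (D * Real.sqrt L) = Real.sqrt ε :=
    div_mul_cancel₀ _ hDt.ne'
  set l := Real.sqrt ε / (D * Real.sqrt L)
  refine ⟨⟨hl0.le, hl1⟩, hconv.add_smul_sub_mem hx hy ⟨hl0.le, hl1⟩, ?_⟩
  set z := x + l • (y - x) with hz
  have hxz : x - z = l • (x - y) := by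
    rw [hz, smul_sub, smul_sub]
    abel
  have hG : ‖G x - G z‖ ≤ L * (l * ‖x - y‖) := by
    have h := hGlip x z
    rwa [hxz, norm_smul, Real.norm_of_nonneg hl0.le] at h
  have hinner : ⟪G x, x - y⟫ - ⟪G z, x - y⟫ ≤ L * l * D ^ 2 := by
    calc ⟪G x, x - y⟫ - ⟪G z, x - y⟫ = ⟪G x - G z, x - y⟫ := (inner_sub_left _ _ _).symm
      _ ≤ ‖G x - G z‖ * ‖x - y‖ := real_inner_le_norm _ _
      _ ≤ L * (l * ‖x - y‖) * ‖x - y‖ := by gcongr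
      _ = L * l * ‖x - y‖ ^ 2 := by ring
      _ ≤ L * l * D ^ 2 := by gcongr
  rw [hxz, inner_smul_right]
  calc ε = l * (2 * D * (Real.sqrt L * Real.sqrt ε) - L * l * D ^ 2) := by
        linear_combination (l * (D * Real.sqrt L) - Real.sqrt ε) * hlD - hs2 -
          l ^ 2 * D ^ 2 * ht2
    _ < l * ⟪G z, x - y⟫ := mul_lt_mul_of_pos_left (by linarith) hl0
end
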